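/- Suppose the solution to the parameter-dependent boundary-value problem L(ε)y = f(·,ε), B(ε)y = c(ε) depends continuously on the parameter ε at ε = 0, i.e., conditions (∗) and (∗∗) hold. Then the problem satisfies Condition (0), Limit Condition (I), and Limit Condition (II). -/

import Mathlib

open Set Filter Topology

noncomputable section

/-- `x` belongs to the Hölder space `C^{n,α}([a,b],ℂ)`: it is `n` times continuously
differentiable on `[a,b]` and the Hölder seminorm of `x⁽ⁿ⁾` is finite. -/
def HolMem (a b : ℝ) (n : ℕ) (α : ℝ) (x : ℝ → ℂ) : Prop :=
  ContDiffOn ℝ n x (Set.Icc a b) ∧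
    ∃ C : ℝ, ∀ t₁ ∈ Set.Icc a b, ∀ t₂ ∈ Set.Icc a b, t₁ < t₂ →
      ‖iteratedDerivWithin n x (Set.Icc a b) t₂ - iteratedDerivWithin n x (Set.Icc a b) t₁‖ ≤
        C * (t₂ - t₁) ^ α

/-- The Hölder seminorm `‖x‖'_{n,α}`. -/
def holSemiNorm (a b : ℝ) (n : ℕ) (α : ℝ) (x : ℝ → ℂ) : ℝ :=
  sSup { s : ℝ | ∃ t₁ ∈ Set.Icc a b, ∃ t₂ ∈ Set.Icc a b, t₁ < t₂ ∧
    s = ‖iteratedDerivWithin n x (Set.Icc a b) t₂ - iteratedDerivWithin n x (Set.Icc a b) t₁‖ /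
        (t₂ - t₁) ^ α }

/-- The Hölder norm `‖x‖_{n,α} = ∑_{j=0}^n max_{[a,b]} |x⁽ʲ⁾| + ‖x‖'_{n,α}`. -/
def holNorm (a b : ℝ) (n : ℕ) (α : ℝ) (x : ℝ → ℂ) : ℝ :=
  (∑ j ∈ Finset.range (n + 1),
      sSup { s : ℝ | ∃ t ∈ Set.Icc a b, s = ‖iteratedDerivWithin j x (Set.Icc a b) t‖ }) +
    holSemiNorm a b n α x

/-- Vector-valued Hölder class `(C^{n,α})^k`. -/
def vHolMem (a b : ℝ) (n : ℕ) (α : ℝ) {k : ℕ} (x : ℝ → (Fin k → ℂ)) : Prop :=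
  ∀ i, HolMem a b n α (fun t => x t i)

/-- Norm on `(C^{n,α})^k`: the sum of the norms of the entries. -/
def vHolNorm (a b : ℝ) (n : ℕ) (α : ℝ) {k : ℕ} (x : ℝ → (Fin k → ℂ)) : ℝ :=
  ∑ i, holNorm a b n α (fun t => x t i)

/-- Matrix-valued Hölder class `(C^{n,α})^{k×l}`. -/
def mHolMem (a b : ℝ) (n : ℕ) (α : ℝ) {k l : ℕ} (X : ℝ → Matrix (Fin k) (Fin l) ℂ) : Prop :=
  ∀ i j, HolMem a b n α (fun t => X t i j)

/-- Norm on `(C^{n,α})^{k×l}`: the sum of the norms of the entries. -/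
def mHolNorm (a b : ℝ) (n : ℕ) (α : ℝ) {k l : ℕ} (X : ℝ → Matrix (Fin k) (Fin l) ℂ) : ℝ :=
  ∑ i, ∑ j, holNorm a b n α (fun t => X t i j)

/-- Entrywise `p`-th derivative of a vector-valued function on `[a,b]`. -/
def vDeriv (a b : ℝ) (p : ℕ) {k : ℕ} (y : ℝ → (Fin k → ℂ)) : ℝ → (Fin k → ℂ) :=
  fun t i => iteratedDerivWithin p (fun s => y s i) (Set.Icc a b) t

/-- Entrywise `p`-th derivative of a matrix-valued function on `[a,b]`. -/
def mDeriv (a b : ℝ) (p : ℕ) {k l : ℕ} (Y : ℝ → Matrix (Fin k) (Fin l) ℂ) :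
    ℝ → Matrix (Fin k) (Fin l) ℂ :=
  fun t i j => iteratedDerivWithin p (fun s => Y s i j) (Set.Icc a b) t

/-- The differential expression `(L y)(t) = y⁽ʳ⁾(t) + ∑_{j=1}^r A_{r-j}(t) y⁽ʳ⁻ʲ⁾(t)`;
here `A j` denotes the coefficient matrix of `y⁽ʲ⁾`, for `0 ≤ j ≤ r-1`. -/
def Lop (a b : ℝ) (r : ℕ) {m : ℕ} (A : Fin r → ℝ → Matrix (Fin m) (Fin m) ℂ)
    (y : ℝ → (Fin m → ℂ)) : ℝ → (Fin m → ℂ) :=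
  fun t => vDeriv a b r y t + ∑ j : Fin r, (A j t).mulVec (vDeriv a b (j : ℕ) y t)

/-- The matrix analogue of `Lop`, applied to matrix-valued functions. -/
def LopM (a b : ℝ) (r : ℕ) {m k : ℕ} (A : Fin r → ℝ → Matrix (Fin m) (Fin m) ℂ)
    (Z : ℝ → Matrix (Fin m) (Fin k) ℂ) : ℝ → Matrix (Fin m) (Fin k) ℂ :=
  fun t => mDeriv a b r Z t + ∑ j : Fin r, A j t * mDeriv a b (j : ℕ) Z t

/-- `y` is a solution in `(C^{n+r,α})^m` of the problem `L y = f` on `[a,b]`, `B y = c`. -/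
def IsSol (a b : ℝ) (n : ℕ) (α : ℝ) (r m : ℕ)
    (A : Fin r → ℝ → Matrix (Fin m) (Fin m) ℂ)
    (B : (ℝ → (Fin m → ℂ)) →ₗ[ℂ] (Fin (r * m) → ℂ))
    (f : ℝ → (Fin m → ℂ)) (c : Fin (r * m) → ℂ) (y : ℝ → (Fin m → ℂ)) : Prop :=
  vHolMem a b (n + r) α y ∧ (∀ t ∈ Set.Icc a b, Lop a b r A y t = f t) ∧ B y = c

/-- Limit Condition (I): `A_{r-j}(·,ε) → A_{r-j}(·,0)` in `(C^{n,α})^{m×m}` as `ε → 0+`. -/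
def CondI (a b : ℝ) (n : ℕ) (α : ℝ) (r m : ℕ)
    (A : ℝ → Fin r → ℝ → Matrix (Fin m) (Fin m) ℂ) : Prop :=
  ∀ j : Fin r,
    Tendsto (fun ε => mHolNorm a b n α (fun t => A ε j t - A 0 j t))
      (nhdsWithin 0 (Set.Ioi 0)) (nhds 0)

/-- Limit Condition (II): `B(ε)y → B(0)y` in `ℂ^{rm}` as `ε → 0+`,
for every `y ∈ (C^{n+r,α})^m`. -/
def CondII (a b : ℝ) (n : ℕ) (α : ℝ) (r m : ℕ)
    (B : ℝ → (ℝ → (Fin m → ℂ)) →ₗ[ℂ] (Fin (r * m) → ℂ)) : Prop :=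
  ∀ y : ℝ → (Fin m → ℂ), vHolMem a b (n + r) α y →
    Tendsto (fun ε => B ε y) (nhdsWithin 0 (Set.Ioi 0)) (nhds (B 0 y))

/-- Condition (0): the homogeneous problem `L(0)y = 0`, `B(0)y = 0` has only the
trivial solution in `(C^{n+r,α})^m`. -/
def Cond0 (a b : ℝ) (n : ℕ) (α : ℝ) (r m : ℕ)
    (A : Fin r → ℝ → Matrix (Fin m) (Fin m) ℂ)
    (B : (ℝ → (Fin m → ℂ)) →ₗ[ℂ] (Fin (r * m) → ℂ)) : Prop :=
  ∀ y : ℝ → (Fin m → ℂ), vHolMem a b (n + r) α y →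
    (∀ t ∈ Set.Icc a b, Lop a b r A y t = 0) → B y = 0 →
    ∀ t ∈ Set.Icc a b, y t = 0

/-- Condition (∗): for every `ε ∈ [0,ε₁)` and arbitrary data `f ∈ (C^{n,α})^m`, `c ∈ ℂ^{rm}`,
the problem `L(ε)y = f`, `B(ε)y = c` has a unique solution `y ∈ (C^{n+r,α})^m`
(uniqueness is understood as equality on `[a,b]`). -/
def CondStar (a b : ℝ) (n : ℕ) (α : ℝ) (r m : ℕ) (ε₁ : ℝ)
    (A : ℝ → Fin r → ℝ → Matrix (Fin m) (Fin m) ℂ)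
    (B : ℝ → (ℝ → (Fin m → ℂ)) →ₗ[ℂ] (Fin (r * m) → ℂ)) : Prop :=
  ∀ ε ∈ Set.Ico (0 : ℝ) ε₁, ∀ f : ℝ → (Fin m → ℂ), vHolMem a b n α f →
    ∀ c : Fin (r * m) → ℂ,
      ∃ y, IsSol a b n α r m (A ε) (B ε) f c y ∧
        ∀ y', IsSol a b n α r m (A ε) (B ε) f c y' → Set.EqOn y' y (Set.Icc a b)

/-- Condition (∗∗): if `f(·,ε) → f(·,0)` in `(C^{n,α})^m` and `c(ε) → c(0)` in `ℂ^{rm}`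
as `ε → 0+`, then the solutions satisfy `y(·,ε) → y(·,0)` in `(C^{n+r,α})^m`. -/
def CondStarStar (a b : ℝ) (n : ℕ) (α : ℝ) (r m : ℕ) (ε₁ : ℝ)
    (A : ℝ → Fin r → ℝ → Matrix (Fin m) (Fin m) ℂ)
    (B : ℝ → (ℝ → (Fin m → ℂ)) →ₗ[ℂ] (Fin (r * m) → ℂ)) : Prop :=
  ∀ (f : ℝ → ℝ → (Fin m → ℂ)) (c : ℝ → Fin (r * m) → ℂ) (y : ℝ → ℝ → (Fin m → ℂ)),
    (∀ ε ∈ Set.Ico (0 : ℝ) ε₁, vHolMem a b n α (f ε) ∧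
      IsSol a b n α r m (A ε) (B ε) (f ε) (c ε) (y ε)) →
    Tendsto (fun ε => vHolNorm a b n α (fun t => f ε t - f 0 t))
      (nhdsWithin 0 (Set.Ioi 0)) (nhds 0) →
    Tendsto c (nhdsWithin 0 (Set.Ioi 0)) (nhds (c 0)) →
    Tendsto (fun ε => vHolNorm a b (n + r) α (fun t => y ε t - y 0 t))
      (nhdsWithin 0 (Set.Ioi 0)) (nhds 0)


/-! ### Basic facts on the scalar Hölder norm -/

def supN (a b : ℝ) (x : ℝ → ℂ) : ℝ :=
  sSup { s : ℝ | ∃ t ∈ Set.Icc a b, s = ‖x t‖ }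

def holQ (a b : ℝ) (α : ℝ) (x : ℝ → ℂ) : ℝ :=
  sSup { s : ℝ | ∃ t₁ ∈ Set.Icc a b, ∃ t₂ ∈ Set.Icc a b, t₁ < t₂ ∧
    s = ‖x t₂ - x t₁‖ / (t₂ - t₁) ^ α }

lemma holNorm_zero_eq (a b α : ℝ) (x : ℝ → ℂ) :
    holNorm a b 0 α x = supN a b x + holQ a b α x := by
  simp [holNorm, holSemiNorm, supN, holQ]

lemma holNorm_succ_eq (a b α : ℝ) (n : ℕ) (x : ℝ → ℂ) :
    holNorm a b (n + 1) α x = supN a b x + holNorm a b n α (derivWithin x (Icc a b)) := by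
  unfold holNorm holSemiNorm supN
  rw [Finset.sum_range_succ']
  simp only [iteratedDerivWithin_succ', iteratedDerivWithin_zero]
  ring

lemma supN_nonneg (a b : ℝ) (x : ℝ → ℂ) : 0 ≤ supN a b x := by
  apply Real.sSup_nonneg
  rintro _ ⟨t, _, rfl⟩
  positivity

lemma holQ_nonneg (a b α : ℝ) (x : ℝ → ℂ) : 0 ≤ holQ a b α x := by
  apply Real.sSup_nonneg
  rintro _ ⟨t₁, _, t₂, _, h, rfl⟩
  have : 0 ≤ t₂ - t₁ := by linarith
  positivity

lemma holNorm_nonneg (a b α : ℝ) (n : ℕ) (x : ℝ → ℂ) : 0 ≤ holNorm a b n α x := by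
  induction n generalizing x with
  | zero => rw [holNorm_zero_eq]; exact add_nonneg (supN_nonneg _ _ _) (holQ_nonneg _ _ _ _)
  | succ n ih => rw [holNorm_succ_eq]; exact add_nonneg (supN_nonneg _ _ _) (ih _)

lemma supN_le {a b : ℝ} (hab : a < b) {x : ℝ → ℂ} {M : ℝ} (h : ∀ t ∈ Icc a b, ‖x t‖ ≤ M) :
    supN a b x ≤ M := by
  refine csSup_le ⟨_, a, ⟨le_rfl, hab.le⟩, rfl⟩ ?_
  rintro _ ⟨t, ht, rfl⟩
  exact h t ht

lemma le_supN {a b : ℝ} {x : ℝ → ℂ} (hx : ContinuousOn x (Icc a b)) {t : ℝ} (ht : t ∈ Icc a b) :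
    ‖x t‖ ≤ supN a b x := by
  refine le_csSup ?_ ⟨t, ht, rfl⟩
  obtain ⟨C, hC⟩ := isCompact_Icc.exists_bound_of_continuousOn hx
  refine ⟨C, ?_⟩
  rintro _ ⟨t, ht, rfl⟩
  exact hC t ht

lemma holQ_le {a b α : ℝ} (hab : a < b) {x : ℝ → ℂ} {M : ℝ}
    (h : ∀ t₁ ∈ Icc a b, ∀ t₂ ∈ Icc a b, t₁ < t₂ → ‖x t₂ - x t₁‖ ≤ M * (t₂ - t₁) ^ α) :
    holQ a b α x ≤ M := by
  refine csSup_le ⟨_, a, ⟨le_rfl, hab.le⟩, b, ⟨hab.le, le_rfl⟩, hab, rfl⟩ ?_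
  rintro _ ⟨t₁, h₁, t₂, h₂, h₁₂, rfl⟩
  rw [div_le_iff₀ (Real.rpow_pos_of_pos (by linarith) _)]
  exact h _ h₁ _ h₂ h₁₂

lemma holMem_zero_iff {a b α : ℝ} {x : ℝ → ℂ} :
    HolMem a b 0 α x ↔ ContinuousOn x (Icc a b) ∧ ∃ C : ℝ, ∀ t₁ ∈ Icc a b, ∀ t₂ ∈ Icc a b,
      t₁ < t₂ → ‖x t₂ - x t₁‖ ≤ C * (t₂ - t₁) ^ α := by
  simp [HolMem, contDiffOn_zero]

lemma le_holQ {a b α : ℝ} {x : ℝ → ℂ} (hx : HolMem a b 0 α x) :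
    ∀ t₁ ∈ Icc a b, ∀ t₂ ∈ Icc a b, t₁ < t₂ →
      ‖x t₂ - x t₁‖ ≤ holQ a b α x * (t₂ - t₁) ^ α := by
  intro t₁ h₁ t₂ h₂ h
  rw [← div_le_iff₀ (Real.rpow_pos_of_pos (by linarith) _)]
  refine le_csSup ?_ ⟨t₁, h₁, t₂, h₂, h, rfl⟩
  obtain ⟨C, hC⟩ := (holMem_zero_iff.1 hx).2
  refine ⟨C, ?_⟩
  rintro _ ⟨t₁, h₁, t₂, h₂, h₁₂, rfl⟩
  rw [div_le_iff₀ (Real.rpow_pos_of_pos (by linarith) _)]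
  exact hC _ h₁ _ h₂ h₁₂

lemma holMem_succ_iff {a b α : ℝ} (hab : a < b) {n : ℕ} {x : ℝ → ℂ} :
    HolMem a b (n + 1) α x ↔ DifferentiableOn ℝ x (Icc a b) ∧
      HolMem a b n α (derivWithin x (Icc a b)) := by
  unfold HolMem
  simp only [iteratedDerivWithin_succ']
  push_cast
  rw [contDiffOn_succ_iff_derivWithin (uniqueDiffOn_Icc hab)]
  simp [and_assoc]

lemma HolMem.congr {a b α : ℝ} {n : ℕ} {x y : ℝ → ℂ} (hx : HolMem a b n α x)
    (h : EqOn y x (Icc a b)) : HolMem a b n α y := by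
  refine ⟨hx.1.congr h, ?_⟩
  obtain ⟨C, hC⟩ := hx.2
  refine ⟨C, fun t₁ h₁ t₂ h₂ h₁₂ => ?_⟩
  rw [iteratedDerivWithin_congr h h₁, iteratedDerivWithin_congr h h₂]
  exact hC _ h₁ _ h₂ h₁₂

lemma supN_congr {a b : ℝ} {x y : ℝ → ℂ} (h : EqOn y x (Icc a b)) :
    supN a b y = supN a b x := by
  unfold supN
  congr 1
  ext s
  constructor
  · rintro ⟨t, ht, rfl⟩; exact ⟨t, ht, by rw [h ht]⟩
  · rintro ⟨t, ht, rfl⟩; exact ⟨t, ht, by rw [h ht]⟩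

lemma holQ_congr {a b α : ℝ} {x y : ℝ → ℂ} (h : EqOn y x (Icc a b)) :
    holQ a b α y = holQ a b α x := by
  unfold holQ
  congr 1
  ext s
  constructor
  · rintro ⟨t, ht, t', ht', hh, rfl⟩; exact ⟨t, ht, t', ht', hh, by rw [h ht, h ht']⟩
  · rintro ⟨t, ht, t', ht', hh, rfl⟩; exact ⟨t, ht, t', ht', hh, by rw [h ht, h ht']⟩

lemma holNorm_congr {a b α : ℝ} {n : ℕ} {x y : ℝ → ℂ}
    (h : EqOn y x (Icc a b)) : holNorm a b n α y = holNorm a b n α x := by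
  induction n generalizing x y with
  | zero => rw [holNorm_zero_eq, holNorm_zero_eq, supN_congr h, holQ_congr h]
  | succ n ih =>
    rw [holNorm_succ_eq, holNorm_succ_eq, supN_congr h, ih]
    intro t ht
    exact derivWithin_congr h (h ht)

lemma HolMem.continuousOn {a b α : ℝ} {n : ℕ} {x : ℝ → ℂ} (hx : HolMem a b n α x) :
    ContinuousOn x (Icc a b) := hx.1.continuousOn

lemma le_holNorm {a b α : ℝ} {n : ℕ} {x : ℝ → ℂ} (hx : HolMem a b n α x) {t : ℝ}
    (ht : t ∈ Icc a b) : ‖x t‖ ≤ holNorm a b n α x := by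
  refine (le_supN hx.continuousOn ht).trans ?_
  cases n with
  | zero => rw [holNorm_zero_eq]; linarith [holQ_nonneg a b α x]
  | succ n => rw [holNorm_succ_eq]; linarith [holNorm_nonneg a b α n (derivWithin x (Icc a b))]

lemma hol_add {a b α : ℝ} (hab : a < b) {n : ℕ} {x y : ℝ → ℂ} (hx : HolMem a b n α x)
    (hy : HolMem a b n α y) : HolMem a b n α (fun t => x t + y t) ∧
      holNorm a b n α (fun t => x t + y t) ≤ holNorm a b n α x + holNorm a b n α y := by
  have hs : ∀ {x y : ℝ → ℂ}, ContinuousOn x (Icc a b) → ContinuousOn y (Icc a b) →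
      supN a b (fun t => x t + y t) ≤ supN a b x + supN a b y := fun hx hy =>
    supN_le hab fun t ht => (norm_add_le _ _).trans (add_le_add (le_supN hx ht) (le_supN hy ht))
  induction n generalizing x y with
  | zero =>
    have key : ∀ t₁ ∈ Icc a b, ∀ t₂ ∈ Icc a b, t₁ < t₂ →
      ‖(x t₂ + y t₂) - (x t₁ + y t₁)‖ ≤ (holQ a b α x + holQ a b α y) * (t₂ - t₁) ^ α := by
      intro t₁ h₁ t₂ h₂ h
      calc _ = ‖(x t₂ - x t₁) + (y t₂ - y t₁)‖ := by congr 1; ring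
        _ ≤ _ := norm_add_le _ _
        _ ≤ _ := by rw [add_mul]; exact add_le_add (le_holQ hx _ h₁ _ h₂ h) (le_holQ hy _ h₁ _ h₂ h)
    refine ⟨holMem_zero_iff.2 ⟨hx.continuousOn.add hy.continuousOn, _, key⟩, ?_⟩
    simp only [holNorm_zero_eq]
    linarith [hs hx.continuousOn hy.continuousOn, holQ_le hab key]
  | succ n ih =>
    have hx' := (holMem_succ_iff hab).1 hx
    have hy' := (holMem_succ_iff hab).1 hy
    have e : EqOn (derivWithin (fun t => x t + y t) (Icc a b))
      (fun t => derivWithin x (Icc a b) t + derivWithin y (Icc a b) t) (Icc a b) := fun t ht =>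
      derivWithin_fun_add (hx'.1 t ht) (hy'.1 t ht)
    have := ih hx'.2 hy'.2
    refine ⟨(holMem_succ_iff hab).2 ⟨hx'.1.add hy'.1, this.1.congr e⟩, ?_⟩
    rw [holNorm_succ_eq, holNorm_succ_eq, holNorm_succ_eq, holNorm_congr e]
    linarith [hs hx.continuousOn hy.continuousOn, this.2]

lemma hol_cmul {a b α : ℝ} (hab : a < b) {n : ℕ} {x : ℝ → ℂ} (c : ℂ) (hx : HolMem a b n α x) :
    HolMem a b n α (fun t => c * x t) ∧
      holNorm a b n α (fun t => c * x t) ≤ ‖c‖ * holNorm a b n α x := by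
  have hs : ∀ {x : ℝ → ℂ}, ContinuousOn x (Icc a b) →
      supN a b (fun t => c * x t) ≤ ‖c‖ * supN a b x := fun hx =>
    supN_le hab fun t ht => by
      rw [norm_mul]; exact mul_le_mul_of_nonneg_left (le_supN hx ht) (norm_nonneg _)
  induction n generalizing x with
  | zero =>
    have key : ∀ t₁ ∈ Icc a b, ∀ t₂ ∈ Icc a b, t₁ < t₂ →
      ‖c * x t₂ - c * x t₁‖ ≤ (‖c‖ * holQ a b α x) * (t₂ - t₁) ^ α := by
      intro t₁ h₁ t₂ h₂ h
      rw [← mul_sub, norm_mul, mul_assoc]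
      exact mul_le_mul_of_nonneg_left (le_holQ hx _ h₁ _ h₂ h) (norm_nonneg _)
    refine ⟨holMem_zero_iff.2 ⟨continuousOn_const.mul hx.continuousOn, _, key⟩, ?_⟩
    simp only [holNorm_zero_eq]
    linarith [hs hx.continuousOn, holQ_le hab key]
  | succ n ih =>
    have hx' := (holMem_succ_iff hab).1 hx
    have e : EqOn (derivWithin (fun t => c * x t) (Icc a b))
      (fun t => c * derivWithin x (Icc a b) t) (Icc a b) := fun t ht =>
      derivWithin_const_mul c (hx'.1 t ht)
    have := ih hx'.2
    refine ⟨(holMem_succ_iff hab).2 ⟨hx'.1.const_mul c, this.1.congr e⟩, ?_⟩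
    rw [holNorm_succ_eq, holNorm_succ_eq, holNorm_congr e]
    linarith [hs hx.continuousOn, this.2]

lemma lip_hol {a b α : ℝ} (hα0 : 0 < α) (hα1 : α ≤ 1) {x : ℝ → ℂ}
    (hx : DifferentiableOn ℝ x (Icc a b)) {M : ℝ} (hM0 : 0 ≤ M)
    (hM : ∀ t ∈ Icc a b, ‖derivWithin x (Icc a b) t‖ ≤ M) :
    ∀ t₁ ∈ Icc a b, ∀ t₂ ∈ Icc a b, t₁ < t₂ →
      ‖x t₂ - x t₁‖ ≤ (M * (b - a) ^ (1 - α)) * (t₂ - t₁) ^ α := by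
  intro t₁ h₁ t₂ h₂ h
  have := (convex_Icc a b).norm_image_sub_le_of_norm_derivWithin_le hx hM h₁ h₂
  refine this.trans ?_
  rw [mul_assoc]
  apply mul_le_mul_of_nonneg_left _ hM0
  have hp : 0 < t₂ - t₁ := by linarith
  rw [Real.norm_of_nonneg hp.le]
  calc t₂ - t₁ = (t₂ - t₁) ^ (1 - α) * (t₂ - t₁) ^ α := by
        rw [← Real.rpow_add hp]; simp
    _ ≤ _ := by
      apply mul_le_mul_of_nonneg_right _ (by positivity)
      apply Real.rpow_le_rpow hp.le _ (by linarith)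
      linarith [h₁.1, h₂.2]

lemma holMem_of_contDiffOn {a b α : ℝ} (hab : a < b) (hα0 : 0 < α) (hα1 : α ≤ 1) {n : ℕ}
    {x : ℝ → ℂ} (hx : ContDiffOn ℝ ((n + 1 : ℕ)) x (Icc a b)) : HolMem a b n α x := by
  induction n generalizing x with
  | zero =>
    have hd : DifferentiableOn ℝ x (Icc a b) := hx.differentiableOn (by simp)
    have hc := hx.continuousOn_derivWithin (uniqueDiffOn_Icc hab) (by simp)
    exact holMem_zero_iff.2 ⟨hx.continuousOn, _, lip_hol hα0 hα1 hd (supN_nonneg _ _ _)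
      fun t ht => le_supN hc ht⟩
  | succ n ih =>
    rw [Nat.cast_add_one, contDiffOn_succ_iff_derivWithin (uniqueDiffOn_Icc hab)] at hx
    exact (holMem_succ_iff hab).2 ⟨hx.1, ih hx.2.2⟩

lemma hol_embed {a b α : ℝ} (hab : a < b) (hα0 : 0 < α) (hα1 : α ≤ 1) (n : ℕ) :
    ∃ C : ℝ, 0 ≤ C ∧ ∀ x, HolMem a b (n + 1) α x → HolMem a b n α x ∧
      holNorm a b n α x ≤ C * holNorm a b (n + 1) α x := by
  have hb : 0 ≤ (b - a) ^ (1 - α) := Real.rpow_nonneg (by linarith) _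
  refine ⟨1 + (b - a) ^ (1 - α), by positivity, fun x hx => 
    ⟨holMem_of_contDiffOn hab hα0 hα1 hx.1, ?_⟩⟩
  induction n generalizing x with
  | zero =>
    have hx' := (holMem_succ_iff hab).1 hx
    rw [holNorm_succ_eq, holNorm_zero_eq, holNorm_zero_eq]
    have h1 := holQ_le hab (lip_hol hα0 hα1 hx'.1 (supN_nonneg _ _ _)
      fun t ht => le_supN hx'.2.continuousOn ht)
    have h2 := supN_nonneg a b x
    have h3 := supN_nonneg a b (derivWithin x (Icc a b))
    have h4 := holQ_nonneg a b α (derivWithin x (Icc a b))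
    nlinarith [mul_nonneg hb h2, mul_nonneg hb h4]
  | succ n ih =>
    have hx' := (holMem_succ_iff hab).1 hx
    rw [holNorm_succ_eq, holNorm_succ_eq _ _ _ (n+1)]
    have h2 := supN_nonneg a b x
    nlinarith [mul_nonneg hb h2, ih _ hx'.2]

lemma hol_mul {a b α : ℝ} (hab : a < b) (hα0 : 0 < α) (hα1 : α ≤ 1) (n : ℕ) :
    ∃ C : ℝ, 0 ≤ C ∧ ∀ x y, HolMem a b n α x → HolMem a b n α y →
      HolMem a b n α (fun t => x t * y t) ∧
      holNorm a b n α (fun t => x t * y t) ≤ C * (holNorm a b n α x * holNorm a b n α y) := by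
  have hs : ∀ {x y : ℝ → ℂ}, ContinuousOn x (Icc a b) → ContinuousOn y (Icc a b) →
      supN a b (fun t => x t * y t) ≤ supN a b x * supN a b y := fun hx hy =>
    supN_le hab fun t ht => by
      rw [norm_mul]
      exact mul_le_mul (le_supN hx ht) (le_supN hy ht) (norm_nonneg _) (supN_nonneg _ _ _)
  induction n with
  | zero =>
    refine ⟨1, zero_le_one, fun x y hx hy => ?_⟩
    have key : ∀ t₁ ∈ Icc a b, ∀ t₂ ∈ Icc a b, t₁ < t₂ →
      ‖x t₂ * y t₂ - x t₁ * y t₁‖ ≤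
        (supN a b x * holQ a b α y + holQ a b α x * supN a b y) * (t₂ - t₁) ^ α := by
      intro t₁ h₁ t₂ h₂ h
      calc _ = ‖x t₂ * (y t₂ - y t₁) + (x t₂ - x t₁) * y t₁‖ := by congr 1; ring
        _ ≤ ‖x t₂‖ * ‖y t₂ - y t₁‖ + ‖x t₂ - x t₁‖ * ‖y t₁‖ := by
          rw [← norm_mul, ← norm_mul]; exact norm_add_le _ _
        _ ≤ supN a b x * (holQ a b α y * (t₂ - t₁) ^ α)
            + (holQ a b α x * (t₂ - t₁) ^ α) * supN a b y := by
          have := le_holQ hx _ h₁ _ h₂ h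
          have := le_holQ hy _ h₁ _ h₂ h
          have := le_supN hx.continuousOn h₂
          have := le_supN hy.continuousOn h₁
          have := supN_nonneg a b x
          have := (norm_nonneg _).trans (le_holQ hx _ h₁ _ h₂ h)
          gcongr
        _ = _ := by ring
    refine ⟨holMem_zero_iff.2 ⟨hx.continuousOn.mul hy.continuousOn, _, key⟩, ?_⟩
    simp only [holNorm_zero_eq]
    nlinarith [hs hx.continuousOn hy.continuousOn, holQ_le hab key,
      mul_nonneg (holQ_nonneg a b α x) (holQ_nonneg a b α y)]
  | succ n ih =>
    obtain ⟨C, hC0, hC⟩ := ih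
    obtain ⟨E, hE0, hE⟩ := hol_embed hab hα0 hα1 n
    refine ⟨1 + 2 * (C * E), by positivity, fun x y hx hy => ?_⟩
    have hx' := (holMem_succ_iff hab).1 hx
    have hy' := (holMem_succ_iff hab).1 hy
    have e : EqOn (derivWithin (fun t => x t * y t) (Icc a b))
      (fun t => derivWithin x (Icc a b) t * y t + x t * derivWithin y (Icc a b) t)
        (Icc a b) := fun t ht =>
      derivWithin_fun_mul (hx'.1 t ht) (hy'.1 t ht)
    obtain ⟨m1, n1⟩ := hC _ _ hx'.2 (hE _ hy).1
    obtain ⟨m2, n2⟩ := hC _ _ (hE _ hx).1 hy'.2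
    obtain ⟨m3, n3⟩ := hol_add hab m1 m2
    refine ⟨(holMem_succ_iff hab).2 ⟨hx'.1.mul hy'.1, m3.congr e⟩, ?_⟩
    have ex := (hE _ hx).2
    have ey := (hE _ hy).2
    have dx : holNorm a b n α (derivWithin x (Icc a b)) ≤ holNorm a b (n+1) α x := by
      rw [holNorm_succ_eq]; linarith [supN_nonneg a b x]
    have dy : holNorm a b n α (derivWithin y (Icc a b)) ≤ holNorm a b (n+1) α y := by
      rw [holNorm_succ_eq]; linarith [supN_nonneg a b y]
    have sx : supN a b x ≤ holNorm a b (n+1) α x := by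
      rw [holNorm_succ_eq]; linarith [holNorm_nonneg a b α n (derivWithin x (Icc a b))]
    have sy : supN a b y ≤ holNorm a b (n+1) α y := by
      rw [holNorm_succ_eq]; linarith [holNorm_nonneg a b α n (derivWithin y (Icc a b))]
    rw [holNorm_succ_eq, holNorm_congr e]
    have nx := holNorm_nonneg a b α (n+1) x
    have ny := holNorm_nonneg a b α (n+1) y
    have s1 : supN a b x * supN a b y ≤ holNorm a b (n+1) α x * holNorm a b (n+1) α y :=
      mul_le_mul sx sy (supN_nonneg _ _ _) nx
    have s2 : C * (holNorm a b n α (derivWithin x (Icc a b)) * holNorm a b n α y) ≤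
        C * (holNorm a b (n+1) α x * (E * holNorm a b (n+1) α y)) :=
      mul_le_mul_of_nonneg_left (mul_le_mul dx ey (holNorm_nonneg _ _ _ _ _) nx) hC0
    have s3 : C * (holNorm a b n α x * holNorm a b n α (derivWithin y (Icc a b))) ≤
        C * ((E * holNorm a b (n+1) α x) * holNorm a b (n+1) α y) :=
      mul_le_mul_of_nonneg_left (mul_le_mul ex dy (holNorm_nonneg _ _ _ _ _) (by positivity)) hC0
    linarith [hs hx.continuousOn hy.continuousOn]

lemma hol_deriv {a b α : ℝ} (hab : a < b) (hα0 : 0 < α) (hα1 : α ≤ 1) (j : ℕ) :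
    ∀ (s N : ℕ), s + j ≤ N → 
    ∃ C : ℝ, 0 ≤ C ∧ ∀ x, HolMem a b N α x → HolMem a b s α (iteratedDerivWithin j x (Icc a b)) ∧
      holNorm a b s α (iteratedDerivWithin j x (Icc a b)) ≤ C * holNorm a b N α x := by
  induction j with
  | zero =>
    intro s N h
    simp only [iteratedDerivWithin_zero]
    induction N, h using Nat.le_induction with
    | base => exact ⟨1, zero_le_one, fun x hx => ⟨hx, by simp⟩⟩
    | succ N _ ih =>
      obtain ⟨C, hC0, hC⟩ := ih
      obtain ⟨E, hE0, hE⟩ := hol_embed hab hα0 hα1 N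
      refine ⟨C * E, by positivity, fun x hx => ⟨(hC x (hE x hx).1).1, ?_⟩⟩
      refine (hC x (hE x hx).1).2.trans ?_
      rw [mul_assoc]
      exact mul_le_mul_of_nonneg_left (hE x hx).2 hC0
  | succ j ih =>
    intro s N h
    obtain ⟨N, rfl⟩ : ∃ N', N = N' + 1 := ⟨N - 1, by omega⟩
    obtain ⟨C, hC0, hC⟩ := ih s N (by omega)
    refine ⟨C, hC0, fun x hx => ?_⟩
    rw [iteratedDerivWithin_succ']
    have := hC _ ((holMem_succ_iff hab).1 hx).2
    refine ⟨this.1, this.2.trans (mul_le_mul_of_nonneg_left ?_ hC0)⟩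
    rw [holNorm_succ_eq]; linarith [supN_nonneg a b x]

lemma holMem_zero_fun {a b α : ℝ} {n : ℕ} : HolMem a b n α (fun _ => 0) := by
  refine ⟨contDiffOn_const, 0, ?_⟩
  intro t₁ h₁ t₂ h₂ h
  simp

lemma holNorm_zero_fun {a b α : ℝ} (hab : a < b) {n : ℕ} : holNorm a b n α (fun _ => 0) = 0 := by
  have := (hol_cmul hab 0 (holMem_zero_fun (a := a) (b := b) (α := α) (n := n))).2
  simp at this
  exact le_antisymm this (holNorm_nonneg _ _ _ _ _)

lemma hol_sub {a b α : ℝ} (hab : a < b) {n : ℕ} {x y : ℝ → ℂ} (hx : HolMem a b n α x)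
    (hy : HolMem a b n α y) : HolMem a b n α (fun t => x t - y t) := by
  have := (hol_add hab hx (hol_cmul hab (-1) hy).1).1
  simpa [sub_eq_add_neg] using this

lemma hol_sum {a b α : ℝ} (hab : a < b) {n : ℕ} {ι : Type*} (s : Finset ι) {x : ι → ℝ → ℂ}
    (hx : ∀ i ∈ s, HolMem a b n α (x i)) :
    HolMem a b n α (fun t => ∑ i ∈ s, x i t) ∧
      holNorm a b n α (fun t => ∑ i ∈ s, x i t) ≤ ∑ i ∈ s, holNorm a b n α (x i) := by
  classical
  induction s using Finset.induction_on with
  | empty => simp [holMem_zero_fun, holNorm_zero_fun hab]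
  | insert i s hi ih =>
    simp only [Finset.sum_insert hi]
    have h1 := ih fun j hj => hx j (Finset.mem_insert_of_mem hj)
    have h2 := hol_add hab (hx i (Finset.mem_insert_self _ _)) h1.1
    exact ⟨h2.1, by linarith [h2.2, h1.2]⟩

/-! ### Matrix-valued functions over arbitrary finite index types -/

def gM (a b : ℝ) (n : ℕ) (α : ℝ) {ι κ : Type} (X : ℝ → Matrix ι κ ℂ) : Prop :=
  ∀ i j, HolMem a b n α (fun t => X t i j)

def gN (a b : ℝ) (n : ℕ) (α : ℝ) {ι κ : Type} [Fintype ι] [Fintype κ]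
    (X : ℝ → Matrix ι κ ℂ) : ℝ :=
  ∑ i, ∑ j, holNorm a b n α (fun t => X t i j)

section gmat
variable {a b α : ℝ} {n : ℕ} {ι κ μ : Type} [Fintype ι] [Fintype κ] [Fintype μ]

lemma gN_nonneg (X : ℝ → Matrix ι κ ℂ) : 0 ≤ gN a b n α X :=
  Finset.sum_nonneg fun _ _ => Finset.sum_nonneg fun _ _ => holNorm_nonneg _ _ _ _ _

lemma gN_entry_le (X : ℝ → Matrix ι κ ℂ) (i : ι) (j : κ) :
    holNorm a b n α (fun t => X t i j) ≤ gN a b n α X := by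
  unfold gN
  refine le_trans ?_ (Finset.single_le_sum
    (f := fun i => ∑ j, holNorm a b n α (fun t => X t i j))
    (fun i _ => Finset.sum_nonneg fun _ _ => holNorm_nonneg _ _ _ _ _) (Finset.mem_univ i))
  exact Finset.single_le_sum
    (f := fun j => holNorm a b n α (fun t => X t i j))
    (fun i _ => holNorm_nonneg _ _ _ _ _) (Finset.mem_univ j)

lemma gN_congr {X Y : ℝ → Matrix ι κ ℂ} (h : EqOn X Y (Icc a b)) :
    gN a b n α X = gN a b n α Y := by
  unfold gN
  refine Finset.sum_congr rfl fun i _ => Finset.sum_congr rfl fun j _ => holNorm_congr ?_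
  intro t ht
  simp only [h ht]

lemma g_add (hab : a < b) {X Y : ℝ → Matrix ι κ ℂ} (hX : gM a b n α X) (hY : gM a b n α Y) :
    gM a b n α (fun t => X t + Y t) ∧
      gN a b n α (fun t => X t + Y t) ≤ gN a b n α X + gN a b n α Y := by
  refine ⟨fun i j => (hol_add hab (hX i j) (hY i j)).1, ?_⟩
  unfold gN
  rw [← Finset.sum_add_distrib]
  refine Finset.sum_le_sum fun i _ => ?_
  rw [← Finset.sum_add_distrib]
  exact Finset.sum_le_sum fun j _ => (hol_add hab (hX i j) (hY i j)).2

lemma g_neg (hab : a < b) {X : ℝ → Matrix ι κ ℂ} (hX : gM a b n α X) :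
    gM a b n α (fun t => - X t) ∧ gN a b n α (fun t => - X t) ≤ gN a b n α X := by
  have : ∀ i j, HolMem a b n α (fun t => (- X t) i j) ∧
      holNorm a b n α (fun t => (- X t) i j) ≤ holNorm a b n α (fun t => X t i j) := by
    intro i j
    simpa using hol_cmul hab (-1) (hX i j)
  exact ⟨fun i j => (this i j).1, Finset.sum_le_sum fun i _ => Finset.sum_le_sum fun j _ =>
    (this i j).2⟩

lemma g_mul (hab : a < b) (hα0 : 0 < α) (hα1 : α ≤ 1) {C : ℝ} (hC0 : 0 ≤ C)
    (hC : ∀ x y, HolMem a b n α x → HolMem a b n α y →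
      HolMem a b n α (fun t => x t * y t) ∧
      holNorm a b n α (fun t => x t * y t) ≤ C * (holNorm a b n α x * holNorm a b n α y))
    {X : ℝ → Matrix ι κ ℂ} {Y : ℝ → Matrix κ μ ℂ}
    (hX : gM a b n α X) (hY : gM a b n α Y) :
    gM a b n α (fun t => X t * Y t) ∧
      gN a b n α (fun t => X t * Y t) ≤ C * (gN a b n α X * gN a b n α Y) := by
  have key : ∀ i j, HolMem a b n α (fun t => (X t * Y t) i j) ∧
      holNorm a b n α (fun t => (X t * Y t) i j) ≤
      C * ((∑ k, holNorm a b n α (fun t => X t i k)) * ∑ k, holNorm a b n α (fun t => Y t k j)) := by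
    intro i j
    simp only [Matrix.mul_apply]
    have := hol_sum hab Finset.univ (x := fun k t => X t i k * Y t k j)
      fun k _ => (hC _ _ (hX i k) (hY k j)).1
    refine ⟨this.1, this.2.trans ?_⟩
    rw [Finset.sum_mul, Finset.mul_sum]
    refine Finset.sum_le_sum fun k _ => (hC _ _ (hX i k) (hY k j)).2.trans ?_
    refine mul_le_mul_of_nonneg_left (mul_le_mul_of_nonneg_left ?_ (holNorm_nonneg _ _ _ _ _)) hC0
    exact Finset.single_le_sum (f := fun k => holNorm a b n α (fun t => Y t k j))
      (fun i _ => holNorm_nonneg _ _ _ _ _) (Finset.mem_univ k)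
  refine ⟨fun i j => (key i j).1, ?_⟩
  unfold gN
  rw [Finset.sum_comm (f := fun k j => holNorm a b n α (fun t => Y t k j)), Finset.sum_mul_sum,
    Finset.mul_sum]
  refine Finset.sum_le_sum fun i _ => ?_
  rw [Finset.mul_sum]
  exact Finset.sum_le_sum fun j _ => (key i j).2

end gmat

lemma contDiffOn_det {ι : Type} [Fintype ι] [DecidableEq ι] {s : Set ℝ} {k : ℕ}
    {X : ℝ → Matrix ι ι ℂ} (hX : ∀ i j, ContDiffOn ℝ k (fun t => X t i j) s) :
    ContDiffOn ℝ k (fun t => (X t).det) s := by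
  simp only [Matrix.det_apply']
  refine ContDiffOn.sum fun σ _ => contDiffOn_const.mul ?_
  exact contDiffOn_prod fun i _ => hX _ _

lemma contDiffOn_matInv {ι : Type} [Fintype ι] [DecidableEq ι] {s : Set ℝ} {k : ℕ}
    {X : ℝ → Matrix ι ι ℂ} (hX : ∀ i j, ContDiffOn ℝ k (fun t => X t i j) s)
    (h0 : ∀ t ∈ s, (X t).det ≠ 0) :
    ∀ i j, ContDiffOn ℝ k (fun t => (X t)⁻¹ i j) s := by
  intro i j
  simp only [Matrix.inv_def, Ring.inverse_eq_inv', Matrix.smul_apply, smul_eq_mul,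
    Matrix.adjugate_apply]
  refine ((contDiffOn_det hX).inv h0).mul (contDiffOn_det ?_)
  intro p q
  by_cases hp : p = j
  · subst hp
    simp only [Matrix.updateRow_self]
    exact contDiffOn_const
  · simp only [Matrix.updateRow_ne hp]
    exact hX p q

lemma tendsto_matInv {ι : Type} [Fintype ι] [DecidableEq ι] {l : Filter ℝ}
    {X : ℝ → Matrix ι ι ℂ} {X0 : Matrix ι ι ℂ} (h : Tendsto X l (𝓝 X0)) (h0 : X0.det ≠ 0) :
    Tendsto (fun e => (X e)⁻¹) l (𝓝 X0⁻¹) := by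
  simp only [Matrix.inv_def, Ring.inverse_eq_inv']
  have h1 : Tendsto (fun e => (X e).det) l (𝓝 X0.det) :=
    ((continuous_id.matrix_det).tendsto X0).comp h
  have h2 : Tendsto (fun e => (X e).adjugate) l (𝓝 X0.adjugate) :=
    ((continuous_id.matrix_adjugate).tendsto X0).comp h
  exact (h1.inv₀ h0).smul h2

/-! ### Uniqueness for the Cauchy problem -/

lemma gronwall_two {E : Type} [NormedAddCommGroup E] [NormedSpace ℝ E] {a b K t₀ : ℝ}
    {f f' : ℝ → E} (hf' : ∀ t ∈ Icc a b, HasDerivWithinAt f (f' t) (Icc a b) t)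
    (ht₀ : t₀ ∈ Icc a b) (h0 : f t₀ = 0) (hK : ∀ t ∈ Icc a b, ‖f' t‖ ≤ K * ‖f t‖) :
    ∀ t ∈ Icc a b, f t = 0 := by
  have hc : ContinuousOn f (Icc a b) := fun t ht => (hf' t ht).continuousWithinAt
  intro t ht
  rcases le_total t₀ t with h | h
  · refine eq_zero_of_abs_deriv_le_mul_abs_self_of_eq_zero_right (a := t₀) (b := b) (K := K)
      (f := f) (f' := f') (hc.mono (Icc_subset_Icc_left ht₀.1)) ?_ h0 ?_ t ⟨h, ht.2⟩
    · intro x hx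
      exact (hf' x ⟨ht₀.1.trans hx.1, hx.2.le⟩).mono_of_mem_nhdsWithin
        (Icc_mem_nhdsGE_of_mem ⟨ht₀.1.trans hx.1, hx.2⟩)
    · intro x hx
      exact hK x ⟨ht₀.1.trans hx.1, hx.2.le⟩
  · have := eq_zero_of_abs_deriv_le_mul_abs_self_of_eq_zero_right (a := -t₀) (b := -a) (K := K)
      (f := fun s => f (-s)) (f' := fun s => -f' (-s)) ?_ ?_ (by simpa using h0) ?_ (-t)
      ⟨by linarith, by linarith [ht.1]⟩
    · simpa using this
    · refine hc.comp continuous_neg.continuousOn ?_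
      intro s hs
      exact ⟨by linarith [hs.2], by linarith [hs.1, ht₀.2]⟩
    · intro x hx
      have hm : -x ∈ Icc a b := ⟨by linarith [hx.2], by linarith [hx.1, ht₀.2]⟩
      have hh : HasDerivWithinAt f (f' (-x)) (Iic (-x)) (-x) :=
        (hf' (-x) hm).mono_of_mem_nhdsWithin
          (Icc_mem_nhdsLE_of_mem ⟨by linarith [hx.2], hm.2⟩)
      have := HasDerivWithinAt.scomp (h := fun s : ℝ => -s) (h' := (-1 : ℝ)) (t' := Iic (-x))
        (s := Ici x) x hh ((hasDerivAt_neg x).hasDerivWithinAt) (fun s hs => by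
          simpa using hs)
      simpa [Function.comp_def] using this
    · intro x hx
      have hm : -x ∈ Icc a b := ⟨by linarith [hx.2], by linarith [hx.1, ht₀.2]⟩
      simpa using hK _ hm

lemma ode_unique {a b : ℝ} (hab : a < b) {n : ℕ} {α : ℝ} {m r : ℕ} (hr : 1 ≤ r)
    {A : Fin r → ℝ → Matrix (Fin m) (Fin m) ℂ} (hA : ∀ j, mHolMem a b n α (A j))
    {y : ℝ → Fin m → ℂ} (hy : vHolMem a b (n + r) α y)
    (hL : ∀ t ∈ Icc a b, Lop a b r A y t = 0) {t₀ : ℝ} (ht₀ : t₀ ∈ Icc a b)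
    (h0 : ∀ j : Fin r, vDeriv a b j y t₀ = 0) : ∀ t ∈ Icc a b, y t = 0 := by
  let U : ℝ → (Fin r × Fin m → ℂ) := fun t p => vDeriv a b p.1 y t p.2
  let U' : ℝ → (Fin r × Fin m → ℂ) := fun t p => vDeriv a b (p.1 + 1) y t p.2
  let S : ℝ := ∑ i, ∑ j, ∑ k, holNorm a b n α (fun t => A j t i k)
  have hS0 : 0 ≤ S := Finset.sum_nonneg fun _ _ => Finset.sum_nonneg fun _ _ =>
    Finset.sum_nonneg fun _ _ => holNorm_nonneg _ _ _ _ _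
  have main := gronwall_two (f := U) (f' := U') (K := 1 + S) (a := a) (b := b) (t₀ := t₀)
    ?_ ht₀ ?_ ?_
  · intro t ht
    ext i
    have := congrFun (main t ht) (⟨0, hr⟩, i)
    simpa [U, vDeriv] using this
  · intro t ht
    rw [hasDerivWithinAt_pi]
    rintro ⟨j, i⟩
    have hd := (hy i).1.differentiableOn_iteratedDerivWithin (m := j)
      (by exact_mod_cast (show (j : ℕ) < n + r by omega)) (uniqueDiffOn_Icc hab)
    have := (hd t ht).hasDerivWithinAt
    simp only [U', vDeriv, iteratedDerivWithin_succ]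
    exact this
  · ext ⟨j, i⟩
    exact congrFun (h0 j) i
  · intro t ht
    have hU : ∀ j i, ‖vDeriv a b (j : Fin r) y t i‖ ≤ ‖U t‖ := fun j i => norm_le_pi_norm (U t) (j, i)
    refine (pi_norm_le_iff_of_nonneg (by positivity)).2 ?_
    rintro ⟨j, i⟩
    by_cases hj : (j : ℕ) + 1 < r
    · have : ‖U' t (j, i)‖ ≤ ‖U t‖ := hU ⟨j + 1, hj⟩ i
      nlinarith [norm_nonneg (U t)]
    · have hj' : (j : ℕ) + 1 = r := by omega
      have e := congrFun (hL t ht) i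
      simp only [Lop, Pi.add_apply, Pi.zero_apply, Finset.sum_apply, Matrix.mulVec, dotProduct] at e
      have e' : U' t (j, i) = - ∑ j : Fin r, ∑ k, A j t i k * vDeriv a b j y t k := by
        simp only [U', hj']
        exact eq_neg_of_add_eq_zero_left e
      rw [e', norm_neg]
      have : ‖∑ j : Fin r, ∑ k, A j t i k * vDeriv a b j y t k‖ ≤ S * ‖U t‖ := by
        calc _ ≤ ∑ j : Fin r, ∑ k, ‖A j t i k * vDeriv a b j y t k‖ :=
              (norm_sum_le _ _).trans (Finset.sum_le_sum fun j _ => norm_sum_le _ _)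
          _ ≤ ∑ j : Fin r, ∑ k, holNorm a b n α (fun t => A j t i k) * ‖U t‖ := by
              refine Finset.sum_le_sum fun j _ => Finset.sum_le_sum fun k _ => ?_
              rw [norm_mul]
              exact mul_le_mul (le_holNorm (hA j i k) ht) (hU j k) (norm_nonneg _)
                (holNorm_nonneg _ _ _ _ _)
          _ = (∑ j : Fin r, ∑ k, holNorm a b n α (fun t => A j t i k)) * ‖U t‖ := by
              simp only [Finset.sum_mul]
          _ ≤ _ := by
              refine mul_le_mul_of_nonneg_right ?_ (norm_nonneg _)
              exact Finset.single_le_sum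
                (f := fun i => ∑ j, ∑ k, holNorm a b n α (fun t => A j t i k))
                (fun i _ => Finset.sum_nonneg fun _ _ =>
                  Finset.sum_nonneg fun _ _ => holNorm_nonneg _ _ _ _ _) (Finset.mem_univ i)
      nlinarith [norm_nonneg (U t)]

/-! ### Linearity -/

lemma vHolMem_add {a b α : ℝ} (hab : a < b) {N k : ℕ} {y w : ℝ → Fin k → ℂ}
    (hy : vHolMem a b N α y) (hw : vHolMem a b N α w) : vHolMem a b N α (y + w) :=
  fun i => (hol_add hab (hy i) (hw i)).1

lemma vHolMem_smul {a b α : ℝ} (hab : a < b) {N k : ℕ} {y : ℝ → Fin k → ℂ} (c : ℂ)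
    (hy : vHolMem a b N α y) : vHolMem a b N α (c • y) :=
  fun i => (hol_cmul hab c (hy i)).1

lemma vHolMem_sub {a b α : ℝ} (hab : a < b) {N k : ℕ} {y w : ℝ → Fin k → ℂ}
    (hy : vHolMem a b N α y) (hw : vHolMem a b N α w) : vHolMem a b N α (y - w) :=
  fun i => hol_sub hab (hy i) (hw i)

lemma vDeriv_sub {a b α : ℝ} (hab : a < b) {N k p : ℕ} (hp : p ≤ N) {y w : ℝ → Fin k → ℂ}
    (hy : vHolMem a b N α y) (hw : vHolMem a b N α w) {t : ℝ} (ht : t ∈ Icc a b) :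
    vDeriv a b p (y - w) t = vDeriv a b p y t - vDeriv a b p w t := by
  ext i
  exact iteratedDerivWithin_sub ht (uniqueDiffOn_Icc hab)
    (((hy i).1 t ht).of_le (by exact_mod_cast hp)) (((hw i).1 t ht).of_le (by exact_mod_cast hp))

lemma vDeriv_add {a b α : ℝ} (hab : a < b) {N k p : ℕ} (hp : p ≤ N) {y w : ℝ → Fin k → ℂ}
    (hy : vHolMem a b N α y) (hw : vHolMem a b N α w) {t : ℝ} (ht : t ∈ Icc a b) :
    vDeriv a b p (y + w) t = vDeriv a b p y t + vDeriv a b p w t := by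
  ext i
  exact iteratedDerivWithin_add ht (uniqueDiffOn_Icc hab)
    (((hy i).1 t ht).of_le (by exact_mod_cast hp)) (((hw i).1 t ht).of_le (by exact_mod_cast hp))

lemma vDeriv_smul {a b : ℝ} {k p : ℕ} {y : ℝ → Fin k → ℂ} (c : ℂ) {t : ℝ} :
    vDeriv a b p (c • y) t = c • vDeriv a b p y t := by
  ext i
  exact iteratedDerivWithin_const_mul_field c (fun s => y s i)

lemma v_sum {a b α : ℝ} (hab : a < b) {N k : ℕ} {ι : Type} (s : Finset ι)
    {z : ι → ℝ → Fin k → ℂ} (hz : ∀ q, vHolMem a b N α (z q)) (c : ι → ℂ) :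
    vHolMem a b N α (∑ q ∈ s, c q • z q) ∧ ∀ p ≤ N, ∀ t ∈ Icc a b,
      vDeriv a b p (∑ q ∈ s, c q • z q) t = ∑ q ∈ s, c q • vDeriv a b p (z q) t := by
  classical
  induction s using Finset.induction_on with
  | empty =>
    refine ⟨fun i => holMem_zero_fun, fun p _ t ht => ?_⟩
    ext i
    simp only [Finset.sum_empty, vDeriv, Pi.zero_apply]
    rw [iteratedDerivWithin_fun_const_zero]
  | insert i s hi ih =>
    simp only [Finset.sum_insert hi]
    refine ⟨vHolMem_add hab (vHolMem_smul hab _ (hz i)) ih.1, fun p hp t ht => ?_⟩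
    rw [vDeriv_add hab hp (vHolMem_smul hab _ (hz i)) ih.1 ht, vDeriv_smul, ih.2 p hp t ht]

lemma Lop_sub {a b α : ℝ} (hab : a < b) {n r m : ℕ} {A : Fin r → ℝ → Matrix (Fin m) (Fin m) ℂ}
    {y w : ℝ → Fin m → ℂ}
    (hy : vHolMem a b (n + r) α y) (hw : vHolMem a b (n + r) α w) {t : ℝ} (ht : t ∈ Icc a b) :
    Lop a b r A (y - w) t = Lop a b r A y t - Lop a b r A w t := by
  have h : ∀ p ≤ r, vDeriv a b p (y - w) t = vDeriv a b p y t - vDeriv a b p w t := fun p hp =>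
    vDeriv_sub hab (by omega) hy hw ht
  simp only [Lop, h r le_rfl, fun j : Fin r => h j j.2.le, Matrix.mulVec_sub,
    Finset.sum_sub_distrib]
  abel

lemma Lop_sum {a b α : ℝ} (hab : a < b) {n r m : ℕ} {A : Fin r → ℝ → Matrix (Fin m) (Fin m) ℂ}
    {ι : Type} (s : Finset ι) {z : ι → ℝ → Fin m → ℂ} (hz : ∀ q, vHolMem a b (n + r) α (z q))
    (c : ι → ℂ) {t : ℝ} (ht : t ∈ Icc a b) :
    Lop a b r A (∑ q ∈ s, c q • z q) t = ∑ q ∈ s, c q • Lop a b r A (z q) t := by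
  have h : ∀ p ≤ r, vDeriv a b p (∑ q ∈ s, c q • z q) t = ∑ q ∈ s, c q • vDeriv a b p (z q) t :=
    fun p hp => (v_sum hab s hz c).2 p (by omega) t ht
  simp only [Lop, h r le_rfl, fun j : Fin r => h j j.2.le, Matrix.mulVec_sum, Matrix.mulVec_smul,
    smul_add, Finset.sum_add_distrib, Finset.smul_sum]
  rw [Finset.sum_comm]

/-! ### Convergence lemmas -/

lemma vHolNorm_tendsto_entry {a b α : ℝ} {N m : ℕ} {l : Filter ℝ} {y : ℝ → ℝ → Fin m → ℂ}
    (h : Tendsto (fun ε => vHolNorm a b N α (y ε)) l (𝓝 0)) (i : Fin m) :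
    Tendsto (fun ε => holNorm a b N α (fun t => y ε t i)) l (𝓝 0) := by
  refine squeeze_zero (fun ε => holNorm_nonneg _ _ _ _ _) (fun ε => ?_) h
  exact Finset.single_le_sum (f := fun i => holNorm a b N α (fun t => y ε t i))
    (fun i _ => holNorm_nonneg _ _ _ _ _) (Finset.mem_univ i)

lemma deriv_tendsto {a b α : ℝ} (hab : a < b) (hα0 : 0 < α) (hα1 : α ≤ 1) {n r m p : ℕ}
    (hp : p ≤ r) {ε₁ : ℝ} (hε₁ : 0 < ε₁) {y : ℝ → ℝ → Fin m → ℂ}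
    (hy : ∀ ε ∈ Ico (0 : ℝ) ε₁, vHolMem a b (n + r) α (y ε))
    (h : Tendsto (fun ε => vHolNorm a b (n + r) α (fun t => y ε t - y 0 t)) (𝓝[>] 0) (𝓝 0))
    (i : Fin m) :
    Tendsto (fun ε => holNorm a b n α (fun t => vDeriv a b p (y ε) t i - vDeriv a b p (y 0) t i))
      (𝓝[>] 0) (𝓝 0) := by
  obtain ⟨C, hC0, hC⟩ := hol_deriv hab hα0 hα1 p n (n + r) (by omega)
  have h1 := (vHolNorm_tendsto_entry h i).const_mul C
  rw [mul_zero] at h1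
  refine squeeze_zero' (Eventually.of_forall fun ε => holNorm_nonneg _ _ _ _ _) ?_ h1
  filter_upwards [Ioo_mem_nhdsGT hε₁] with ε hε
  have m1 := hy ε ⟨hε.1.le, hε.2⟩
  have m0 := hy 0 ⟨le_rfl, hε₁⟩
  have := (hC _ (vHolMem_sub hab m1 m0 i)).2
  refine le_trans (le_of_eq ?_) this
  apply holNorm_congr
  intro t ht
  have e := vDeriv_sub hab (p := p) (by omega) m1 m0 ht
  exact (congrFun e i).symm

lemma gN_tendsto {a b α : ℝ} {n : ℕ} {ι κ : Type} [Fintype ι] [Fintype κ] {l : Filter ℝ}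
    {X : ℝ → ℝ → Matrix ι κ ℂ}
    (h : ∀ i j, Tendsto (fun ε => holNorm a b n α (fun t => X ε t i j)) l (𝓝 0)) :
    Tendsto (fun ε => gN a b n α (X ε)) l (𝓝 0) := by
  unfold gN
  have := tendsto_finsetSum Finset.univ fun i (_ : i ∈ Finset.univ) =>
    tendsto_finsetSum Finset.univ fun j (_ : j ∈ Finset.univ) => h i j
  simpa using this

/-- The coefficients tend to their limits, abstract form. -/
lemma coeff_tendsto {a b α : ℝ} (hab : a < b) (hα0 : 0 < α) (hα1 : α ≤ 1) {n : ℕ}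
    {ι Q : Type} [Fintype ι] [Fintype Q] [DecidableEq Q] {ε₁ : ℝ} (hε₁ : 0 < ε₁)
    {Z As : ℝ → ℝ → Matrix ι Q ℂ} {W : ℝ → ℝ → Matrix Q Q ℂ}
    (hA : ∀ ε ∈ Ico (0 : ℝ) ε₁, gM a b n α (As ε))
    (hZ : ∀ ε ∈ Ico (0 : ℝ) ε₁, gM a b n α (Z ε))
    (hW : ∀ ε ∈ Ico (0 : ℝ) ε₁, gM a b n α (W ε))
    (hV : gM a b n α (fun t => (W 0 t)⁻¹)) (hdet : ∀ t ∈ Icc a b, (W 0 t).det ≠ 0)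
    (hE : ∀ ε ∈ Ico (0 : ℝ) ε₁, ∀ t ∈ Icc a b, Z ε t + As ε t * W ε t = 0)
    (tZ : Tendsto (fun ε => gN a b n α (fun t => Z ε t - Z 0 t)) (𝓝[>] 0) (𝓝 0))
    (tW : Tendsto (fun ε => gN a b n α (fun t => W ε t - W 0 t)) (𝓝[>] 0) (𝓝 0)) :
    Tendsto (fun ε => gN a b n α (fun t => As ε t - As 0 t)) (𝓝[>] 0) (𝓝 0) := by
  obtain ⟨C, hC0, hC⟩ := hol_mul hab hα0 hα1 n
  set v := gN a b n α (fun t => (W 0 t)⁻¹) with hv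
  set a0 := gN a b n α (As 0) with ha0
  have v0 : 0 ≤ v := gN_nonneg _
  have gsub : ∀ {κ μ : Type} {X Y : ℝ → Matrix κ μ ℂ}, gM a b n α X → gM a b n α Y →
      gM a b n α (fun t => X t - Y t) := fun hX hY i j => hol_sub hab (hX i j) (hY i j)
  have h0 : (0 : ℝ) ∈ Ico (0 : ℝ) ε₁ := ⟨le_rfl, hε₁⟩
  have est : ∀ ε ∈ Ico (0 : ℝ) ε₁, gN a b n α (fun t => As ε t - As 0 t) ≤
      C * v * gN a b n α (fun t => Z ε t - Z 0 t)
      + C * C * v * a0 * gN a b n α (fun t => W ε t - W 0 t)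
      + C * C * v * gN a b n α (fun t => W ε t - W 0 t)
        * gN a b n α (fun t => As ε t - As 0 t) := by
    intro ε hε
    have mZ := gsub (hZ ε hε) (hZ 0 h0)
    have mW := gsub (hW ε hε) (hW 0 h0)
    have mD := gsub (hA ε hε) (hA 0 h0)
    have p1 := g_mul hab hα0 hα1 hC0 hC (hA 0 h0) mW
    have p2 := g_mul hab hα0 hα1 hC0 hC mD mW
    have s1 := g_add hab mZ p1.1
    have s2 := g_add hab s1.1 p2.1
    have s3 := g_neg hab s2.1
    have p3 := g_mul hab hα0 hα1 hC0 hC s3.1 hV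
    have e : EqOn (fun t => As ε t - As 0 t)
        (fun t => -(Z ε t - Z 0 t + As 0 t * (W ε t - W 0 t)
          + (As ε t - As 0 t) * (W ε t - W 0 t)) * (W 0 t)⁻¹) (Icc a b) := by
      intro t ht
      have e1 := hE ε hε t ht
      have e0 := hE 0 h0 t ht
      have : -(Z ε t - Z 0 t + As 0 t * (W ε t - W 0 t)
          + (As ε t - As 0 t) * (W ε t - W 0 t)) = (As ε t - As 0 t) * W 0 t := by
        have z1 : Z ε t = - (As ε t * W ε t) := eq_neg_of_add_eq_zero_left e1
        have z0 : Z 0 t = - (As 0 t * W 0 t) := eq_neg_of_add_eq_zero_left e0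
        rw [z1, z0]
        simp only [Matrix.mul_sub, Matrix.sub_mul]
        abel
      simp only [this]
      rw [Matrix.mul_assoc, Matrix.mul_nonsing_inv _ (isUnit_iff_ne_zero.2 (hdet t ht)),
        Matrix.mul_one]
    have q3 := p3.2
    rw [← gN_congr e] at q3
    refine q3.trans ?_
    have : gN a b n α (fun t => -(Z ε t - Z 0 t + As 0 t * (W ε t - W 0 t)
          + (As ε t - As 0 t) * (W ε t - W 0 t))) ≤
        gN a b n α (fun t => Z ε t - Z 0 t) + C * (a0 * gN a b n α (fun t => W ε t - W 0 t))
        + C * (gN a b n α (fun t => As ε t - As 0 t) * gN a b n α (fun t => W ε t - W 0 t)) := by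
      linarith [s3.2, s2.2, s1.2, p1.2, p2.2]
    have := mul_le_mul_of_nonneg_left (mul_le_mul_of_nonneg_right this v0) hC0
    rw [← hv]
    linarith
  have t1 : Tendsto (fun ε => C * C * v * gN a b n α (fun t => W ε t - W 0 t)) (𝓝[>] 0) (𝓝 0) := by
    simpa using tW.const_mul (C * C * v)
  have t2 : Tendsto (fun ε => 2 * (C * v * gN a b n α (fun t => Z ε t - Z 0 t)
      + C * C * v * a0 * gN a b n α (fun t => W ε t - W 0 t))) (𝓝[>] 0) (𝓝 0) := by
    simpa using ((tZ.const_mul (C * v)).add (tW.const_mul (C * C * v * a0))).const_mul 2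
  refine squeeze_zero' (Eventually.of_forall fun ε => gN_nonneg _) ?_ t2
  filter_upwards [Ioo_mem_nhdsGT hε₁, t1.eventually (gt_mem_nhds (show (0 : ℝ) < 1 / 2 by norm_num))]
    with ε hε hs
  have e := est ε ⟨hε.1.le, hε.2⟩
  have := mul_le_mul_of_nonneg_right hs.le
    (gN_nonneg (a := a) (b := b) (n := n) (α := α) (fun t => As ε t - As 0 t))
  linarith

/-- Main Theorem (necessity): if the solution of the problem depends continuously on
the parameter ε at ε = 0 (conditions (∗) and (∗∗)), then the problem satisfies
Condition (0) and Limit Conditions (I) and (II). -/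
theorem main_theorem_necessity
    (a b : ℝ) (hab : a < b) (n : ℕ) (α : ℝ) (hα0 : 0 < α) (hα1 : α ≤ 1)
    (m r : ℕ) (hm : 1 ≤ m) (hr : 2 ≤ r) (ε₀ : ℝ) (hε₀ : 0 < ε₀)
    (A : ℝ → Fin r → ℝ → Matrix (Fin m) (Fin m) ℂ)
    (hA : ∀ ε ∈ Set.Ico (0 : ℝ) ε₀, ∀ j, mHolMem a b n α (A ε j))
    (B : ℝ → (ℝ → (Fin m → ℂ)) →ₗ[ℂ] (Fin (r * m) → ℂ))
    (hB : ∀ ε ∈ Set.Ico (0 : ℝ) ε₀, ∃ K : ℝ, ∀ y : ℝ → (Fin m → ℂ),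
      vHolMem a b (n + r) α y → ‖B ε y‖ ≤ K * vHolNorm a b (n + r) α y)
    (ε₁ : ℝ) (hε₁0 : 0 < ε₁) (hε₁ : ε₁ < ε₀)
    (hstar : CondStar a b n α r m ε₁ A B)
    (hstarstar : CondStarStar a b n α r m ε₁ A B) :
    Cond0 a b n α r m (A 0) (B 0) ∧ CondI a b n α r m A ∧ CondII a b n α r m B := by

  have h0m : (0 : ℝ) ∈ Ico (0 : ℝ) ε₁ := ⟨le_rfl, hε₁0⟩
  have hA' : ∀ ε ∈ Ico (0 : ℝ) ε₁, ∀ j, mHolMem a b n α (A ε j) := fun ε hε =>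
    hA ε ⟨hε.1, hε.2.trans hε₁⟩
  have hzeroMem : ∀ N, vHolMem a b N α (0 : ℝ → Fin m → ℂ) := fun N i => holMem_zero_fun
  -- uniqueness for the homogeneous problem
  have hom : ∀ ε ∈ Ico (0 : ℝ) ε₁, Cond0 a b n α r m (A ε) (B ε) := by
    intro ε hε y hy hL hBy t ht
    obtain ⟨y₀, -, hu⟩ := hstar ε hε 0 (hzeroMem n) 0
    have e1 := hu y ⟨hy, hL, hBy⟩ ht
    have e2 := hu 0 ⟨hzeroMem _, fun t ht => ?_, map_zero _⟩ ht
    · rw [e1, ← e2]; rfl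
    · have := Lop_sub hab (A := A ε) hy hy ht
      simpa using this
  -- fundamental solutions
  let e : Fin r × Fin m ≃ Fin (r * m) := finProdFinEquiv
  have hex : ∀ ε, ∀ q : Fin r × Fin m, ∃ z : ℝ → Fin m → ℂ, ε ∈ Ico (0 : ℝ) ε₁ →
      IsSol a b n α r m (A ε) (B ε) 0 (Pi.single (e q) 1) z := by
    intro ε q
    by_cases hε : ε ∈ Ico (0 : ℝ) ε₁
    · obtain ⟨z, hz, -⟩ := hstar ε hε 0 (hzeroMem n) (Pi.single (e q) 1)
      exact ⟨z, fun _ => hz⟩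
    · exact ⟨0, fun h => absurd h hε⟩
  choose z hz using hex
  have hzc : ∀ q, Tendsto (fun ε => vHolNorm a b (n + r) α (fun t => z ε q t - z 0 q t))
      (𝓝[>] 0) (𝓝 0) := by
    intro q
    refine hstarstar (fun _ => 0) (fun _ => Pi.single (e q) 1) (fun ε => z ε q)
      (fun ε hε => ⟨hzeroMem n, hz ε q hε⟩) ?_ tendsto_const_nhds
    have : vHolNorm a b n α (fun t => (0 : ℝ → Fin m → ℂ) t - (0 : ℝ → Fin m → ℂ) t) = 0 := by
      simp [vHolNorm, holNorm_zero_fun hab]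
    simp only [this]
    exact tendsto_const_nhds
  have hzm : ∀ ε ∈ Ico (0 : ℝ) ε₁, ∀ q, vHolMem a b (n + r) α (z ε q) := fun ε hε q =>
    (hz ε q hε).1
  have hBz : ∀ ε ∈ Ico (0 : ℝ) ε₁, ∀ k : Fin r × Fin m → ℂ, ∀ q,
      B ε (∑ q, k q • z ε q) (e q) = k q := by
    intro ε hε k q
    rw [map_sum, Finset.sum_apply]
    simp only [map_smul, (hz ε _ hε).2.2, Pi.smul_apply, smul_eq_mul, Pi.single_apply,
      e.injective.eq_iff]
    simp
  have hLz : ∀ ε ∈ Ico (0 : ℝ) ε₁, ∀ k : Fin r × Fin m → ℂ, ∀ t ∈ Icc a b,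
      Lop a b r (A ε) (∑ q, k q • z ε q) t = 0 := by
    intro ε hε k t ht
    rw [Lop_sum hab _ (hzm ε hε) k ht]
    refine Finset.sum_eq_zero fun q _ => ?_
    rw [(hz ε q hε).2.1 t ht]
    simp
  let W : ℝ → ℝ → Matrix (Fin r × Fin m) (Fin r × Fin m) ℂ := fun ε t =>
    Matrix.of fun p q => vDeriv a b p.1 (z ε q) t p.2
  let Z : ℝ → ℝ → Matrix (Fin m) (Fin r × Fin m) ℂ := fun ε t =>
    Matrix.of fun i q => vDeriv a b r (z ε q) t i
  let As : ℝ → ℝ → Matrix (Fin m) (Fin r × Fin m) ℂ := fun ε t =>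
    Matrix.of fun i p => A ε p.1 t i p.2
  -- the Wronskian does not vanish
  have hdet : ∀ t ∈ Icc a b, (W 0 t).det ≠ 0 := by
    intro t ht hd
    obtain ⟨k, hk, hk0⟩ := Matrix.exists_mulVec_eq_zero_iff.2 hd
    apply hk
    have vs := v_sum hab Finset.univ (hzm 0 h0m) k
    have hy0 := ode_unique hab (by omega) (hA' 0 h0m) vs.1 (hLz 0 h0m k) ht ?_
    · obtain ⟨K, hK⟩ := hB 0 ⟨le_rfl, hε₀⟩
      have hK' := hK _ vs.1
      have : vHolNorm a b (n + r) α (∑ q, k q • z 0 q) = 0 := by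
        unfold vHolNorm
        refine Finset.sum_eq_zero fun i _ => ?_
        refine Eq.trans ?_ (holNorm_zero_fun hab (α := α) (n := n + r))
        exact holNorm_congr fun s hs => congrFun (hy0 s hs) i
      rw [this, mul_zero] at hK'
      have hB0 := norm_le_zero_iff.1 hK'
      ext q
      rw [← hBz 0 h0m k q, hB0]
      rfl
    · intro j
      rw [vs.2 j (by omega) t ht]
      ext i
      have := congrFun hk0 (j, i)
      simp only [Matrix.mulVec, dotProduct, W, Matrix.of_apply, Pi.zero_apply] at this
      simp only [Finset.sum_apply, Pi.smul_apply, smul_eq_mul, Pi.zero_apply]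
      rw [← this]
      exact Finset.sum_congr rfl fun q _ => mul_comm _ _
  have hDm : ∀ ε ∈ Ico (0 : ℝ) ε₁, ∀ q i, ∀ p ≤ r,
      HolMem a b n α (fun t => vDeriv a b p (z ε q) t i) := by
    intro ε hε q i p hp
    obtain ⟨C, -, hC⟩ := hol_deriv hab hα0 hα1 p n (n + r) (by omega)
    exact (hC _ (hzm ε hε q i)).1
  have tW' : ∀ p q, Tendsto (fun ε => holNorm a b n α (fun t => (W ε t - W 0 t) p q))
      (𝓝[>] 0) (𝓝 0) := by
    intro p q
    exact deriv_tendsto hab hα0 hα1 p.1.2.le hε₁0 (y := fun ε => z ε q)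
      (fun ε hε => hzm ε hε q) (hzc q) p.2
  have hE : ∀ ε ∈ Ico (0 : ℝ) ε₁, ∀ t ∈ Icc a b, Z ε t + As ε t * W ε t = 0 := by
    intro ε hε t ht
    ext i q
    have := congrFun ((hz ε q hε).2.1 t ht) i
    simp only [Lop, Pi.add_apply, Pi.zero_apply, Finset.sum_apply, Matrix.mulVec, dotProduct]
      at this
    simp only [Matrix.add_apply, Matrix.mul_apply, Z, As, W, Matrix.of_apply, Matrix.zero_apply,
      Fintype.sum_prod_type]
    exact this
  have hV : gM a b n α (fun t => (W 0 t)⁻¹) := by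
    intro p q
    refine holMem_of_contDiffOn hab hα0 hα1 (contDiffOn_matInv (fun p q => ?_) hdet p q)
    obtain ⟨C, -, hC⟩ := hol_deriv hab hα0 hα1 p.1 (n + 1) (n + r) (by omega)
    exact (hC _ (hzm 0 h0m q p.2)).1.1
  have tA := coeff_tendsto hab hα0 hα1 hε₁0 (Z := Z) (As := As) (W := W)
    (fun ε hε i p => hA' ε hε p.1 i p.2) (fun ε hε i q => hDm ε hε q i r le_rfl)
    (fun ε hε p q => hDm ε hε q p.2 p.1 p.1.2.le) hV hdet hE
    (gN_tendsto fun i q => deriv_tendsto hab hα0 hα1 le_rfl hε₁0 (y := fun ε => z ε q)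
      (fun ε hε => hzm ε hε q) (hzc q) i) (gN_tendsto tW')
  have tAe : ∀ j i k, Tendsto (fun ε => holNorm a b n α (fun t => (A ε j t - A 0 j t) i k))
      (𝓝[>] 0) (𝓝 0) := by
    intro j i k
    exact squeeze_zero (fun ε => holNorm_nonneg _ _ _ _ _)
      (fun ε => gN_entry_le (fun t => As ε t - As 0 t) i (j, k)) tA
  refine ⟨hom 0 h0m, fun j => gN_tendsto (tAe j), ?_⟩
  -- Limit Condition (II)
  intro y hy
  obtain ⟨C, hC0, hC⟩ := hol_mul hab hα0 hα1 n
  have hyd : ∀ p ≤ r, ∀ i, HolMem a b n α (fun t => vDeriv a b p y t i) := by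
    intro p hp i
    obtain ⟨C, -, hC⟩ := hol_deriv hab hα0 hα1 p n (n + r) (by omega)
    exact (hC _ (hy i)).1
  let f : ℝ → ℝ → Fin m → ℂ := fun ε => Lop a b r (A ε) y
  have hf : ∀ ε ∈ Ico (0 : ℝ) ε₁, vHolMem a b n α (f ε) := by
    intro ε hε i
    simp only [f, Lop, Pi.add_apply, Finset.sum_apply, Matrix.mulVec, dotProduct]
    refine (hol_add hab (hyd r le_rfl i) ?_).1
    refine (hol_sum hab Finset.univ fun j _ => ?_).1
    exact (hol_sum hab Finset.univ fun k _ => (hC _ _ (hA' ε hε j i k) (hyd j j.2.le k)).1).1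
  have hft : Tendsto (fun ε => vHolNorm a b n α (fun t => f ε t - f 0 t)) (𝓝[>] 0) (𝓝 0) := by
    have tb : Tendsto (fun ε => ∑ i : Fin m, ∑ j : Fin r, ∑ k : Fin m,
        C * (holNorm a b n α (fun t => (A ε j t - A 0 j t) i k) *
          holNorm a b n α (fun t => vDeriv a b j y t k))) (𝓝[>] 0) (𝓝 0) := by
      have := tendsto_finsetSum Finset.univ fun i (_ : i ∈ Finset.univ) =>
        tendsto_finsetSum Finset.univ fun j (_ : j ∈ Finset.univ) =>
        tendsto_finsetSum Finset.univ fun k (_ : k ∈ Finset.univ) =>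
        ((tAe j i k).mul_const (holNorm a b n α (fun t => vDeriv a b j y t k))).const_mul C
      simpa using this
    refine squeeze_zero' (Eventually.of_forall fun ε =>
      Finset.sum_nonneg fun i _ => holNorm_nonneg _ _ _ _ _) ?_ tb
    filter_upwards [Ioo_mem_nhdsGT hε₁0] with ε hε
    have hε' : ε ∈ Ico (0 : ℝ) ε₁ := ⟨hε.1.le, hε.2⟩
    refine Finset.sum_le_sum fun i _ => ?_
    have ef : (fun t => (f ε t - f 0 t) i) = fun t => ∑ j : Fin r, ∑ k : Fin m,
        (A ε j t - A 0 j t) i k * vDeriv a b j y t k := by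
      funext t
      simp only [f, Lop, Pi.add_apply, Pi.sub_apply, Finset.sum_apply, Matrix.mulVec, dotProduct,
        Matrix.sub_apply, sub_mul, Finset.sum_sub_distrib]
      ring
    rw [ef]
    have hm : ∀ j k, _ := fun (j : Fin r) (k : Fin m) =>
      hC _ _ (hol_sub hab (hA' ε hε' j i k) (hA' 0 h0m j i k)) (hyd j j.2.le k)
    have h2 : ∀ j, _ := fun (j : Fin r) => hol_sum hab Finset.univ fun k _ => (hm j k).1
    have h3 := hol_sum hab Finset.univ fun j _ => (h2 j).1
    refine h3.2.trans (Finset.sum_le_sum fun j _ => (h2 j).2.trans ?_)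
    exact Finset.sum_le_sum fun k _ => (hm j k).2
  have hwex : ∀ ε, ∃ w : ℝ → Fin m → ℂ, (ε ∈ Ico (0 : ℝ) ε₁ →
      IsSol a b n α r m (A ε) (B ε) (f ε) (B 0 y) w) ∧ (ε = 0 → w = y) := by
    intro ε
    by_cases h : ε = 0
    · subst h
      exact ⟨y, fun _ => ⟨hy, fun _ _ => rfl, rfl⟩, fun _ => rfl⟩
    · by_cases hε : ε ∈ Ico (0 : ℝ) ε₁
      · obtain ⟨w, hw, -⟩ := hstar ε hε (f ε) (hf ε hε) (B 0 y)
        exact ⟨w, fun _ => hw, fun h' => absurd h' h⟩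
      · exact ⟨0, fun h' => absurd h' hε, fun h' => absurd h' h⟩
  choose w hw hw0 using hwex
  have hwt := hstarstar f (fun _ => B 0 y) w (fun ε hε => ⟨hf ε hε, hw ε hε⟩) hft
    tendsto_const_nhds
  have w0 : w 0 = y := hw0 0 rfl
  have ha : a ∈ Icc a b := ⟨le_rfl, hab.le⟩
  let k : ℝ → Fin r × Fin m → ℂ := fun ε q => (B ε y - B 0 y) (e q)
  let u : ℝ → Fin r × Fin m → ℂ := fun ε p =>
    vDeriv a b p.1 (w 0) a p.2 - vDeriv a b p.1 (w ε) a p.2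
  -- expansion of `y - w ε` in fundamental solutions
  have hu : ∀ ε ∈ Ico (0 : ℝ) ε₁, (W ε a).mulVec (k ε) = u ε := by
    intro ε hε
    have vs := v_sum hab Finset.univ (hzm ε hε) (k ε)
    have hmw := (hw ε hε).1
    have hyw := vHolMem_sub hab hy hmw
    have hz0 := hom ε hε ((y - w ε) - ∑ q, k ε q • z ε q) (vHolMem_sub hab hyw vs.1) ?_ ?_
    · ext ⟨j, i⟩
      have hj : (j : ℕ) ≤ n + r := by omega
      have h1 : vDeriv a b j ((y - w ε) - ∑ q, k ε q • z ε q) a i = 0 := by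
        have : EqOn (fun s => ((y - w ε) - ∑ q, k ε q • z ε q) s i) (fun _ => 0) (Icc a b) :=
          fun s hs => congrFun (hz0 s hs) i
        have := iteratedDerivWithin_congr (n := j) this ha
        rw [iteratedDerivWithin_fun_const_zero] at this
        exact this
      rw [vDeriv_sub hab hj hyw vs.1 ha, vDeriv_sub hab hj hy hmw ha, vs.2 j hj a ha] at h1
      simp only [Pi.sub_apply, Finset.sum_apply, Pi.smul_apply, smul_eq_mul] at h1
      simp only [Matrix.mulVec, dotProduct, W, Matrix.of_apply, u, w0]
      rw [sub_eq_zero.1 h1]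
      exact Finset.sum_congr rfl fun q _ => mul_comm _ _
    · intro t ht
      rw [Lop_sub hab hyw vs.1 ht, Lop_sub hab hy hmw ht, hLz ε hε _ t ht, (hw ε hε).2.1 t ht]
      simp [f]
    · ext p
      obtain ⟨q, rfl⟩ := e.surjective p
      rw [map_sub, map_sub, Pi.sub_apply, hBz ε hε, (hw ε hε).2.2]
      simp [k]
  have tu : Tendsto u (𝓝[>] 0) (𝓝 0) := by
    rw [tendsto_pi_nhds]
    intro p
    have h1 := deriv_tendsto hab hα0 hα1 p.1.2.le hε₁0 (fun ε hε => (hw ε hε).1) hwt p.2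
    refine squeeze_zero_norm' ?_ h1
    filter_upwards [Ioo_mem_nhdsGT hε₁0] with ε hε
    have hε' : ε ∈ Ico (0 : ℝ) ε₁ := ⟨hε.1.le, hε.2⟩
    obtain ⟨C', -, hC'⟩ := hol_deriv hab hα0 hα1 p.1 n (n + r) (by omega)
    have := le_holNorm (hol_sub hab (hC' _ ((hw ε hε').1 p.2)).1 (hC' _ ((hw 0 h0m).1 p.2)).1) ha
    rw [norm_sub_rev] at this
    exact this
  have tWa : Tendsto (fun ε => W ε a) (𝓝[>] 0) (𝓝 (W 0 a)) := by
    refine tendsto_pi_nhds.2 fun p => tendsto_pi_nhds.2 fun q => ?_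
    rw [tendsto_iff_norm_sub_tendsto_zero]
    refine squeeze_zero' (Eventually.of_forall fun _ => norm_nonneg _) ?_ (tW' p q)
    filter_upwards [Ioo_mem_nhdsGT hε₁0] with ε hε
    have hε' : ε ∈ Ico (0 : ℝ) ε₁ := ⟨hε.1.le, hε.2⟩
    exact le_holNorm (hol_sub hab (hDm ε hε' q p.2 p.1 p.1.2.le)
      (hDm 0 h0m q p.2 p.1 p.1.2.le)) ha
  have tk : Tendsto k (𝓝[>] 0) (𝓝 0) := by
    have t1 := tendsto_matInv tWa (hdet a ha)
    have t2 : Tendsto (fun ε => ((W ε a)⁻¹).mulVec (u ε)) (𝓝[>] 0) (𝓝 0) := by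
      have c : Continuous fun x : Matrix (Fin r × Fin m) (Fin r × Fin m) ℂ × (Fin r × Fin m → ℂ) =>
          x.1.mulVec x.2 := continuous_fst.matrix_mulVec continuous_snd
      have := (c.tendsto ((W 0 a)⁻¹, 0)).comp (t1.prodMk_nhds tu)
      simpa [Function.comp_def] using this
    have hde : ∀ᶠ ε in 𝓝[>] (0 : ℝ), (W ε a).det ≠ 0 :=
      (((continuous_id.matrix_det).tendsto (W 0 a)).comp tWa).eventually_ne (hdet a ha)
    refine t2.congr' ?_
    filter_upwards [Ioo_mem_nhdsGT hε₁0, hde] with ε hε hd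
    rw [← hu ε ⟨hε.1.le, hε.2⟩, Matrix.mulVec_mulVec,
      Matrix.nonsing_inv_mul _ (isUnit_iff_ne_zero.2 hd), Matrix.one_mulVec]
  rw [tendsto_pi_nhds]
  intro p
  obtain ⟨q, rfl⟩ := e.surjective p
  have := (tendsto_pi_nhds.1 tk q).add_const (B 0 y (e q))
  simpa [k] using this
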